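/- Let φ : S → M ⊕_p L^p[0,1] be a disintegration, where M is ℓ^p or ℓ^p_n, let {C_n} be a partition of S into almost norm-maximizing chains, and g_n = inf φ[C_n]. Then for each ν ∈ S, the projection of φ(ν) onto {0} ⊕ L^p[0,1] equals φ(ν) - Σ_{n : g_n ⪯ φ(ν)} g_n. -/

import Mathlib

open MeasureTheory

/-- The Lebesgue measure on `[0,1]`. -/
noncomputable def vol01 : Measure ℝ := volume.restrict (Set.Icc (0:ℝ) 1)

/-- The space `M ⊕_p L^p[0,1]` where `M = ℓ^p(ι)` (taking `ι = ℕ` gives `ℓ^p`, and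
`ι = Fin n` gives `ℓ^p_n`). -/
abbrev SumSp (ι : Type) (p : ENNReal) : Type :=
  WithLp p ((lp (fun _ : ι => ℂ) p) × (Lp ℂ p vol01))

/-- Disjointness of supports in `M ⊕_p L^p[0,1]`. -/
def DisjSupp {ι : Type} {p : ENNReal} (x y : SumSp ι p) : Prop :=
  (∀ j : ι, ((WithLp.equiv p _ x).1 : ∀ _ : ι, ℂ) j * ((WithLp.equiv p _ y).1 : ∀ _ : ι, ℂ) j = 0) ∧
    (((WithLp.equiv p _ x).2 : ℝ → ℂ) * ((WithLp.equiv p _ y).2 : ℝ → ℂ) =ᵐ[vol01] 0)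

/-- The subvector relation on `M ⊕_p L^p[0,1]`. -/
def Subvec {ι : Type} {p : ENNReal} (x y : SumSp ι p) : Prop :=
  ∃ D : Set ι, ∃ A : Set ℝ, MeasurableSet A ∧
    (∀ j : ι, ((WithLp.equiv p _ x).1 : ∀ _ : ι, ℂ) j =
      D.indicator (fun i => ((WithLp.equiv p _ y).1 : ∀ _ : ι, ℂ) i) j) ∧
    (((WithLp.equiv p _ x).2 : ℝ → ℂ) =ᵐ[vol01] A.indicator ((WithLp.equiv p _ y).2 : ℝ → ℂ))

/-- `S ⊆ ℕ*` is a tree: closed under initial segments. -/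
def IsTree (S : Set (List ℕ)) : Prop :=
  ∀ ν ∈ S, ∀ ν' : List ℕ, ν' <+: ν → ν' ∈ S

/-- `φ` is summative on `S`. -/
def Summative {ι : Type} {p : ENNReal} [Fact (1 ≤ p)]
    (S : Set (List ℕ)) (φ : List ℕ → SumSp ι p) : Prop :=
  ∀ ν ∈ S, (∃ k : ℕ, ν ++ [k] ∈ S) →
    HasSum (fun k : {k : ℕ // ν ++ [k] ∈ S} => φ (ν ++ [k.1])) (φ ν)

/-- `φ` is separating on `S`. -/
def Separating {ι : Type} {p : ENNReal} [Fact (1 ≤ p)]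
    (S : Set (List ℕ)) (φ : List ℕ → SumSp ι p) : Prop :=
  ∀ ν ∈ S, ∀ ν' ∈ S, ¬ ν <+: ν' → ¬ ν' <+: ν → DisjSupp (φ ν) (φ ν')

/-- `φ : S → M ⊕_p L^p[0,1]` is a disintegration. -/
def Disintegration {ι : Type} {p : ENNReal} [Fact (1 ≤ p)]
    (S : Set (List ℕ)) (φ : List ℕ → SumSp ι p) : Prop :=
  IsTree S ∧ Set.InjOn φ S ∧ (∀ ν ∈ S, φ ν ≠ 0) ∧ Summative S φ ∧ Separating S φ ∧
    Dense ((Submodule.span ℂ (φ '' S) : Submodule ℂ (SumSp ι p)) : Set (SumSp ι p))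

/-- `C ⊆ S` is an almost norm-maximizing chain for `φ` (with exponent `pr`). -/
def ANMChain {ι : Type} {p : ENNReal} [Fact (1 ≤ p)]
    (pr : ℝ) (S : Set (List ℕ)) (φ : List ℕ → SumSp ι p) (C : Set (List ℕ)) : Prop :=
  C ⊆ S ∧ IsChain (· <+: ·) C ∧
    ∀ ν ∈ C, (∃ k : ℕ, ν ++ [k] ∈ S) →
      ∃ k : ℕ, ν ++ [k] ∈ C ∧
        ∀ k' : ℕ, ν ++ [k'] ∈ S →
          ‖φ (ν ++ [k'])‖ ^ pr ≤ ‖φ (ν ++ [k])‖ ^ pr + 2 ^ (-((ν.length + 1 : ℕ) : ℝ))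

/-- `g` is the subvector-infimum of `φ[C]`. -/
def SubvecInf {ι : Type} {p : ENNReal} (C : Set (List ℕ))
    (φ : List ℕ → SumSp ι p) (g : SumSp ι p) : Prop :=
  (∀ ν ∈ C, Subvec g (φ ν)) ∧ ∀ h : SumSp ι p, (∀ ν ∈ C, Subvec h (φ ν)) → Subvec h g

/-- The projection of `M ⊕_p L^p[0,1]` onto `{0} ⊕ L^p[0,1]`. -/
noncomputable def ProjL {ι : Type} {p : ENNReal} (x : SumSp ι p) : SumSp ι p :=
  (WithLp.equiv p _).symm (0, (WithLp.equiv p _ x).2)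


section Helpers
variable {ι : Type} {p : ENNReal}

lemma scal_trans {a b c : ℂ} (h : a = 0 ∨ a = b) (h' : b = 0 ∨ b = c) : a = 0 ∨ a = c := by
  grind

lemma scal_disj {h y x : ℂ} (a : h = 0 ∨ h = y) (b : x = 0 ∨ y = 0) : x = 0 ∨ h = 0 := by
  grind

lemma scal_norm {r : ℝ} (hr : 0 < r) {x y z : ℂ} (a : x = 0 ∨ x = z) (b : y = 0 ∨ y = z)
    (c : x = 0 ∨ y = 0) : ‖x‖ ^ r + ‖y‖ ^ r ≤ ‖z‖ ^ r := by
  have n : 0 ≤ ‖z‖ ^ r := by positivity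
  have o : (0:ℝ) ^ r = 0 := Real.zero_rpow hr.ne'
  rcases c with rfl | rfl
  · rcases b with rfl | rfl <;> simp [o, n]
  · rcases a with rfl | rfl <;> simp [o, n]

lemma scal_enorm {r : ℝ} (hr : 0 < r) {x y z : ℂ} (a : x = 0 ∨ x = z) (b : y = 0 ∨ y = z)
    (c : x = 0 ∨ y = 0) : ‖x‖ₑ ^ r + ‖y‖ₑ ^ r ≤ ‖z‖ₑ ^ r := by
  rcases c with rfl | rfl
  · rcases b with rfl | rfl <;> simp [ENNReal.zero_rpow_of_pos hr]
  · rcases a with rfl | rfl <;> simp [ENNReal.zero_rpow_of_pos hr]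

lemma subvec_iff' (x y : SumSp ι p) : Subvec x y ↔
    (∀ j, x.fst j = 0 ∨ x.fst j = y.fst j) ∧
      ∀ᵐ t ∂vol01, x.snd t = 0 ∨ x.snd t = y.snd t := by
  classical
  constructor
  · rintro ⟨D, A, hA, h1, h2⟩
    refine ⟨fun j => ?_, ?_⟩
    · have := h1 j
      by_cases hj : j ∈ D
      · right; rw [Set.indicator_of_mem hj] at this; exact this
      · left; rw [Set.indicator_of_notMem hj] at this; exact this
    · filter_upwards [h2] with t this
      by_cases hj : t ∈ A
      · right; rw [Set.indicator_of_mem hj] at this; exact this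
      · left; rw [Set.indicator_of_notMem hj] at this; exact this
  · rintro ⟨h1, h2⟩
    refine ⟨{j | x.fst j ≠ 0}, {t | x.snd t ≠ 0}, ?_, fun j => ?_, ?_⟩
    · exact (Lp.stronglyMeasurable x.snd).measurable (measurableSet_singleton (0:ℂ)).compl
    · change x.fst j = _
      by_cases hj : x.fst j = 0
      · rw [Set.indicator_of_notMem (by simpa using hj), hj]
      · rw [Set.indicator_of_mem (by simpa using hj)]
        exact (h1 j).resolve_left hj
    · filter_upwards [h2] with t ht
      change x.snd t = _
      by_cases hj : x.snd t = 0
      · rw [Set.indicator_of_notMem (by simpa using hj), hj]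
      · rw [Set.indicator_of_mem (by simpa using hj)]
        exact ht.resolve_left hj

lemma disj_iff' (x y : SumSp ι p) : DisjSupp x y ↔
    (∀ j, x.fst j = 0 ∨ y.fst j = 0) ∧
      ∀ᵐ t ∂vol01, x.snd t = 0 ∨ y.snd t = 0 := by
  unfold DisjSupp
  refine and_congr (forall_congr' fun j => mul_eq_zero) ?_
  refine Filter.eventually_congr (Filter.Eventually.of_forall fun t => ?_)
  exact mul_eq_zero

lemma subvec_refl' (x : SumSp ι p) : Subvec x x := by
  rw [subvec_iff']
  exact ⟨fun j => Or.inr rfl, Filter.Eventually.of_forall fun t => Or.inr rfl⟩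

lemma subvec_trans' {x y z : SumSp ι p} (h : Subvec x y) (h' : Subvec y z) : Subvec x z := by
  rw [subvec_iff'] at *
  refine ⟨fun j => ?_, ?_⟩
  · have a := h.1 j
    have b := h'.1 j
    exact scal_trans a b
  · filter_upwards [h.2, h'.2] with t a b
    exact scal_trans a b

lemma disj_of_subvec {x y h : SumSp ι p} (hd : DisjSupp x y) (hs : Subvec h y) :
    DisjSupp x h := by
  rw [disj_iff'] at *
  rw [subvec_iff'] at hs
  refine ⟨fun j => ?_, ?_⟩
  · have a := hs.1 j
    have b := hd.1 j
    exact scal_disj a b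
  · filter_upwards [hs.2, hd.2] with t a b
    exact scal_disj a b

lemma sumsp_ext {x y : SumSp ι p} (h1 : ∀ j, x.fst j = y.fst j) (h2 : x.snd = y.snd) :
    x = y := by
  apply WithLp.ofLp_injective
  exact Prod.ext (lp.ext (funext h1)) h2

/-- Norm inequality for disjoint subvectors. -/
lemma norm_add_le_of_disj [Fact (1 ≤ p)] (hp : p ≠ ⊤) {x y z : SumSp ι p} (hx : Subvec x z)
    (hy : Subvec y z) (hd : DisjSupp x y) :
    ‖x‖ ^ p.toReal + ‖y‖ ^ p.toReal ≤ ‖z‖ ^ p.toReal := by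
  have hp0 : p ≠ 0 := (zero_lt_one.trans_le Fact.out).ne'
  have hpr : 0 < p.toReal := ENNReal.toReal_pos hp0 hp
  rw [subvec_iff'] at hx hy
  rw [disj_iff'] at hd
  have key : ∀ w : SumSp ι p, ‖w‖ ^ p.toReal = ‖w.fst‖ ^ p.toReal + ‖w.snd‖ ^ p.toReal := by
    intro w
    rw [WithLp.prod_norm_eq_add hpr, ← Real.rpow_mul (by positivity)]
    rw [one_div, inv_mul_cancel₀ hpr.ne', Real.rpow_one]
  have h1 : ‖x.fst‖ ^ p.toReal + ‖y.fst‖ ^ p.toReal ≤ ‖z.fst‖ ^ p.toReal := by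
    refine hasSum_le (fun j => ?_) ((lp.hasSum_norm hpr x.fst).add (lp.hasSum_norm hpr y.fst))
      (lp.hasSum_norm hpr z.fst)
    have a := hx.1 j
    have b := hy.1 j
    have c := hd.1 j
    exact scal_norm hpr a b c
  have key2 : ∀ f : Lp ℂ p vol01, ENNReal.ofReal (‖f‖ ^ p.toReal)
      = ∫⁻ t, ‖f t‖ₑ ^ p.toReal ∂vol01 := by
    intro f
    rw [← ENNReal.ofReal_rpow_of_nonneg (norm_nonneg _) hpr.le, Lp.norm_def,
      ENNReal.ofReal_toReal (Lp.eLpNorm_ne_top f),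
      eLpNorm_eq_lintegral_rpow_enorm_toReal hp0 hp, ← ENNReal.rpow_mul, one_div,
      inv_mul_cancel₀ hpr.ne', ENNReal.rpow_one]
  have h2 : ‖x.snd‖ ^ p.toReal + ‖y.snd‖ ^ p.toReal ≤ ‖z.snd‖ ^ p.toReal := by
    rw [← ENNReal.ofReal_le_ofReal_iff (by positivity), ENNReal.ofReal_add (by positivity)
      (by positivity), key2, key2, key2, ← lintegral_add_left']
    · refine lintegral_mono_ae ?_
      filter_upwards [hx.2, hy.2, hd.2] with t a b c
      exact scal_enorm hpr a b c
    · exact ((Lp.aestronglyMeasurable x.snd).enorm).pow_const _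
  rw [key, key, key]
  linarith

lemma norm_coord_le [Fact (1 ≤ p)] (x : SumSp ι p) (j : ι) : ‖x.fst j‖ ≤ ‖x‖ :=
  (lp.norm_apply_le_norm (zero_lt_one.trans_le (Fact.out : 1 ≤ p)).ne' x.fst j).trans
    (WithLp.norm_fst_le _ x)

/-- evaluation at a coordinate as a continuous linear functional -/
noncomputable def evL [Fact (1 ≤ p)] (j : ι) : SumSp ι p →L[ℂ] ℂ where
  toFun x := x.fst j
  map_add' _ _ := rfl
  map_smul' _ _ := rfl
  cont := (lp.lipschitzWith_one_eval p j).continuous.comp (WithLp.continuous_fst p _ _)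

/-- restriction of the function part to a set -/
noncomputable def resL [Fact (1 ≤ p)] (A : Set ℝ) :
    SumSp ι p →L[ℂ] Lp ℂ p (vol01.restrict A) :=
  (LpToLpRestrictCLM ℝ ℂ ℂ vol01 p A).comp (WithLp.sndL p ℂ _ _)

lemma resL_coe [Fact (1 ≤ p)] (A : Set ℝ) (x : SumSp ι p) :
    resL A x =ᵐ[vol01.restrict A] x.snd :=
  LpToLpRestrictCLM_coeFn ℂ A x.snd

lemma supp_meas (x : SumSp ι p) : MeasurableSet {t | x.snd t ≠ 0} :=
  (Lp.stronglyMeasurable x.snd).measurable (measurableSet_singleton (0:ℂ)).compl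

lemma resL_eq_zero [Fact (1 ≤ p)] {x h : SumSp ι p} (hd : DisjSupp x h) :
    resL {t | h.snd t ≠ 0} x = 0 := by
  rw [disj_iff'] at hd
  apply Lp.ext
  refine (resL_coe _ x).trans (Filter.EventuallyEq.trans ?_ (Lp.coeFn_zero _ _ _).symm)
  rw [Filter.EventuallyEq, ae_restrict_iff' (supp_meas h)]
  filter_upwards [hd.2] with t a b
  exact a.resolve_right b

lemma resL_eq_of_subvec [Fact (1 ≤ p)] {x h : SumSp ι p} (hd : Subvec h x) :
    resL {t | h.snd t ≠ 0} x = resL {t | h.snd t ≠ 0} h := by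
  rw [subvec_iff'] at hd
  apply Lp.ext
  refine (resL_coe _ x).trans (Filter.EventuallyEq.trans ?_ (resL_coe _ h).symm)
  rw [Filter.EventuallyEq, ae_restrict_iff' (supp_meas h)]
  filter_upwards [hd.2] with t a b
  exact (a.resolve_left b).symm

lemma child_subvec [Fact (1 ≤ p)] {S : Set (List ℕ)} {φ : List ℕ → SumSp ι p}
    (hT : IsTree S) (hs : Summative S φ) (hsep : Separating S φ) {ν : List ℕ} {k : ℕ}
    (hk : ν ++ [k] ∈ S) : Subvec (φ (ν ++ [k])) (φ ν) := by
  have hν : ν ∈ S := hT _ hk _ (List.prefix_append _ _)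
  have hsum := hs ν hν ⟨k, hk⟩
  have hdis : ∀ k' : {k : ℕ // ν ++ [k] ∈ S}, k' ≠ ⟨k, hk⟩ →
      DisjSupp (φ (ν ++ [k'.1])) (φ (ν ++ [k])) := by
    intro k' hne
    have hne' : k'.1 ≠ k := fun h => hne (Subtype.ext h)
    refine hsep _ k'.2 _ hk ?_ ?_
    · simpa [List.prefix_append_right_inj] using hne'
    · simpa [List.prefix_append_right_inj] using hne'.symm
  rw [subvec_iff']
  constructor
  · intro j
    by_cases h0 : (φ (ν ++ [k])).fst j = 0
    · exact Or.inl h0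
    · right
      have h1 := (evL (p := p) j).hasSum hsum
      refine HasSum.unique (hasSum_single (⟨k, hk⟩ : {k : ℕ // ν ++ [k] ∈ S}) ?_) h1
      intro k' hne
      exact (((disj_iff' _ _).1 (hdis k' hne)).1 j).resolve_right h0
  · have h1 := (resL (p := p) (ι := ι) {t | (φ (ν ++ [k])).snd t ≠ 0}).hasSum hsum
    have h2 := HasSum.unique (hasSum_single (⟨k, hk⟩ : {k : ℕ // ν ++ [k] ∈ S})
      fun k' hne => resL_eq_zero (hdis k' hne)) h1
    have h3 := (resL_coe {t | (φ (ν ++ [k])).snd t ≠ 0} (φ (ν ++ [k])))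
    have h4 := (resL_coe {t | (φ (ν ++ [k])).snd t ≠ 0} (φ ν))
    simp only at h2
    rw [h2] at h3
    have h5 := h3.symm.trans h4
    rw [Filter.EventuallyEq, ae_restrict_iff' (supp_meas _)] at h5
    filter_upwards [h5] with t ht
    by_cases h0 : (φ (ν ++ [k])).snd t = 0
    · exact Or.inl h0
    · exact Or.inr (ht h0)

lemma prefix_subvec [Fact (1 ≤ p)] {S : Set (List ℕ)} {φ : List ℕ → SumSp ι p}
    (hT : IsTree S) (hs : Summative S φ) (hsep : Separating S φ) {ν ν' : List ℕ}
    (h : ν <+: ν') (hk : ν' ∈ S) : Subvec (φ ν') (φ ν) := by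
  obtain ⟨l, rfl⟩ := h
  induction l using List.reverseRecOn with
  | nil => simpa using subvec_refl' _
  | append_singleton l a ih =>
    rw [← List.append_assoc] at hk ⊢
    exact subvec_trans' (child_subvec hT hs hsep hk) (ih (hT _ hk _ (List.prefix_append _ _)))

/-- Everything is either disjoint from a common subvector of a chain or contains it. -/
lemma dichotomy [Fact (1 ≤ p)] {S : Set (List ℕ)} {φ : List ℕ → SumSp ι p}
    (hT : IsTree S) (hs : Summative S φ) (hsep : Separating S φ) {pr : ℝ} {C : Set (List ℕ)}
    (hC : ANMChain pr S φ C) (hne : C.Nonempty) {h : SumSp ι p}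
    (hh : ∀ ν ∈ C, Subvec h (φ ν)) {μ : List ℕ} (hμ : μ ∈ S) :
    DisjSupp (φ μ) h ∨ Subvec h (φ μ) := by
  by_cases h1 : ∃ ν ∈ C, ¬ μ <+: ν ∧ ¬ ν <+: μ
  · obtain ⟨ν, hν, a, b⟩ := h1
    exact Or.inl (disj_of_subvec (hsep _ hμ _ (hC.1 hν) a b) (hh ν hν))
  · by_cases h2 : ∃ ν ∈ C, μ <+: ν
    · obtain ⟨ν, hν, a⟩ := h2
      exact Or.inr (subvec_trans' (hh ν hν) (prefix_subvec hT hs hsep a (hC.1 hν)))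
    · exfalso
      have h3 : ∀ n : ℕ, ∃ ν ∈ C, n ≤ ν.length := by
        intro n
        induction n with
        | zero => obtain ⟨ν, hν⟩ := hne; exact ⟨ν, hν, Nat.zero_le _⟩
        | succ n ih =>
          obtain ⟨ν, hν, hl⟩ := ih
          have a : ¬ μ <+: ν := fun a => h2 ⟨ν, hν, a⟩
          have b : ν <+: μ := by
            by_contra b
            exact h1 ⟨ν, hν, a, b⟩
          obtain ⟨l, rfl⟩ := b
          cases l with
          | nil => exact absurd (by simp) a
          | cons k l =>
            have : ν ++ [k] ∈ S := hT _ hμ _ ⟨l, by simp⟩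
            obtain ⟨k', hk', -⟩ := hC.2.2 ν hν ⟨k, this⟩
            exact ⟨_, hk', by simp; omega⟩
      obtain ⟨ν, hν, hl⟩ := h3 μ.length
      have b : ν <+: μ := by
        by_contra b
        exact h1 ⟨ν, hν, fun a => h2 ⟨ν, hν, a⟩, b⟩
      have := b.eq_of_length (le_antisymm b.length_le hl)
      exact h2 ⟨ν, hν, this ▸ List.prefix_rfl⟩

/-- A closed subspace containing the range of the disintegration is everything. -/
lemma mem_of_dense [Fact (1 ≤ p)] {S : Set (List ℕ)} {φ : List ℕ → SumSp ι p}
    (hd : Dense ((Submodule.span ℂ (φ '' S) : Submodule ℂ (SumSp ι p)) : Set (SumSp ι p)))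
    (K : Submodule ℂ (SumSp ι p)) (hK : IsClosed (K : Set (SumSp ι p)))
    (h : ∀ μ ∈ S, φ μ ∈ K) (x : SumSp ι p) : x ∈ K := by
  have h1 : Submodule.span ℂ (φ '' S) ≤ K := by
    rw [Submodule.span_le]
    rintro _ ⟨μ, hμ, rfl⟩
    exact h μ hμ
  exact closure_minimal h1 hK (hd x)

lemma common_snd_zero [Fact (1 ≤ p)] {S : Set (List ℕ)} {φ : List ℕ → SumSp ι p}
    (hd : Dense ((Submodule.span ℂ (φ '' S) : Submodule ℂ (SumSp ι p)) : Set (SumSp ι p)))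
    {h : SumSp ι p} (hdi : ∀ μ ∈ S, DisjSupp (φ μ) h ∨ Subvec h (φ μ)) : h.snd = 0 := by
  set A := {t | h.snd t ≠ 0} with hA
  let K : Submodule ℂ (SumSp ι p) :=
    (Submodule.span ℂ {resL A h}).comap (resL (ι := ι) (p := p) A).toLinearMap
  have hK : IsClosed (K : Set (SumSp ι p)) :=
    (Submodule.closed_of_finiteDimensional (Submodule.span ℂ {resL A h})).preimage
      (resL (ι := ι) (p := p) A).continuous
  have hall := mem_of_dense hd K hK (by
    intro μ hμ
    change resL A (φ μ) ∈ Submodule.span ℂ {resL A h}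
    rcases hdi μ hμ with h1 | h1
    · rw [hA, resL_eq_zero h1]; exact zero_mem _
    · rw [hA, resL_eq_of_subvec h1]; exact Submodule.mem_span_singleton_self _)
  have hmem : MemLp (fun t : ℝ => (t : ℂ) * h.snd t) p vol01 := by
    refine MemLp.mono (Lp.memLp h.snd) ?_ ?_
    · exact (Complex.measurable_ofReal.aestronglyMeasurable).mul (Lp.aestronglyMeasurable h.snd)
    · have : ∀ᵐ t ∂vol01, t ∈ Set.Icc (0:ℝ) 1 := ae_restrict_mem measurableSet_Icc
      filter_upwards [this] with t ht
      rw [norm_mul, Complex.norm_real, Real.norm_eq_abs, abs_of_nonneg ht.1]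
      exact mul_le_of_le_one_left (norm_nonneg _) ht.2
  let x : SumSp ι p := WithLp.toLp p (0, hmem.toLp _)
  obtain ⟨c, hc⟩ := Submodule.mem_span_singleton.1 (show resL A x ∈ _ from hall x)
  have e1 := resL_coe A x
  have e2 := resL_coe A h
  have e3 := Lp.coeFn_smul c (resL A h)
  have e4 : ∀ᵐ t ∂vol01.restrict A, x.snd t = (t : ℂ) * h.snd t :=
    ae_restrict_of_ae hmem.coeFn_toLp
  rw [hc] at e3
  have e5 : ∀ᵐ t ∂vol01, t ∈ A → (t:ℂ) * h.snd t = c * h.snd t := by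
    rw [← ae_restrict_iff' (supp_meas h)]
    filter_upwards [e1, e2, e3, e4] with t a1 a2 a3 a4
    rw [← a4, ← a1, a3, Pi.smul_apply, a2, smul_eq_mul]
  have e6 : ∀ᵐ t ∂vol01, t ≠ c.re := by
    have : vol01 {c.re} = 0 := by
      refine le_antisymm ((Measure.restrict_apply_le _ _).trans ?_) zero_le
      simp
    exact (compl_mem_ae_iff.2 this)
  apply Lp.ext
  filter_upwards [e5, e6, Lp.coeFn_zero ℂ p vol01] with t a b z
  rw [z]
  by_contra hne
  have := mul_right_cancel₀ hne (a hne)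
  exact b (by rw [← this]; simp)

lemma common_single [Fact (1 ≤ p)] {S : Set (List ℕ)} {φ : List ℕ → SumSp ι p}
    (hd : Dense ((Submodule.span ℂ (φ '' S) : Submodule ℂ (SumSp ι p)) : Set (SumSp ι p)))
    {h : SumSp ι p} (hdi : ∀ μ ∈ S, DisjSupp (φ μ) h ∨ Subvec h (φ μ)) {i j : ι}
    (hj : h.fst j ≠ 0) (hij : i ≠ j) : h.fst i = 0 := by
  classical
  by_contra hi
  let L : SumSp ι p →L[ℂ] ℂ := h.fst j • evL i - h.fst i • evL j
  have hL : ∀ x : SumSp ι p, L x = h.fst j * x.fst i - h.fst i * x.fst j := fun x => rfl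
  have hall := mem_of_dense hd L.ker L.isClosed_ker (by
    intro μ hμ
    rw [LinearMap.mem_ker]
    change L (φ μ) = 0
    rw [hL]
    rcases hdi μ hμ with h1 | h1
    · rw [disj_iff'] at h1
      rw [(h1.1 i).resolve_right hi, (h1.1 j).resolve_right hj]; simp
    · rw [subvec_iff'] at h1
      rw [(h1.1 i).resolve_left hi, (h1.1 j).resolve_left hj]; ring)
  have h2 : L (WithLp.toLp p (lp.single p j 1, 0)) = 0 := hall _
  rw [hL] at h2
  simp [lp.single_apply, hij] at h2
  exact hi h2


lemma branch_comp [Fact (1 ≤ p)] {S : Set (List ℕ)} {φ : List ℕ → SumSp ι p}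
    (hsep : Separating S φ) {j : ι} {μ μ' : List ℕ} (h : μ ∈ S) (h' : μ' ∈ S)
    (hj : (φ μ).fst j ≠ 0) (hj' : (φ μ').fst j ≠ 0) : μ <+: μ' ∨ μ' <+: μ := by
  by_contra hcon
  push Not at hcon
  have := ((disj_iff' _ _).1 (hsep _ h _ h' hcon.1 hcon.2)).1 j
  exact this.elim hj hj'

lemma branch_prefix [Fact (1 ≤ p)] {S : Set (List ℕ)} {φ : List ℕ → SumSp ι p}
    (hT : IsTree S) (hs : Summative S φ) (hsep : Separating S φ) {j : ι} {μ μ' : List ℕ}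
    (h' : μ' ∈ S) (hpre : μ <+: μ') (hj' : (φ μ').fst j ≠ 0) :
    (φ μ).fst j = (φ μ').fst j :=
  ((((subvec_iff' _ _).1 (prefix_subvec hT hs hsep hpre h')).1 j).resolve_left hj').symm

lemma branch_eq [Fact (1 ≤ p)] {S : Set (List ℕ)} {φ : List ℕ → SumSp ι p}
    (hT : IsTree S) (hs : Summative S φ) (hsep : Separating S φ) {j : ι} {μ μ' : List ℕ}
    (h : μ ∈ S) (h' : μ' ∈ S)
    (hj : (φ μ).fst j ≠ 0) (hj' : (φ μ').fst j ≠ 0) :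
    (φ μ).fst j = (φ μ').fst j := by
  rcases branch_comp hsep h h' hj hj' with a | a
  · exact branch_prefix hT hs hsep h' a hj'
  · exact (branch_prefix hT hs hsep h a hj).symm

lemma branch_child [Fact (1 ≤ p)] {S : Set (List ℕ)} {φ : List ℕ → SumSp ι p}
    (hs : Summative S φ) {j : ι} {μ : List ℕ} (h : μ ∈ S)
    (hj : (φ μ).fst j ≠ 0) (hc : ∃ k, μ ++ [k] ∈ S) :
    ∃ k, μ ++ [k] ∈ S ∧ (φ (μ ++ [k])).fst j ≠ 0 := by
  by_contra hcon
  push Not at hcon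
  have h1 := (evL (p := p) j).hasSum (hs μ h hc)
  have h2 : (fun k : {k : ℕ // μ ++ [k] ∈ S} => evL (p := p) j (φ (μ ++ [k.1]))) = 0 := by
    funext k
    exact hcon k.1 k.2
  have h3 := h1.unique (by
    change HasSum (fun k : {k : ℕ // μ ++ [k] ∈ S} => evL (p := p) j (φ (μ ++ [k.1]))) 0
    rw [h2]; exact hasSum_zero)
  exact hj h3

lemma sibling_disj [Fact (1 ≤ p)] {S : Set (List ℕ)} {φ : List ℕ → SumSp ι p}
    (hsep : Separating S φ) {μ : List ℕ} {k k' : ℕ} (h : μ ++ [k] ∈ S) (h' : μ ++ [k'] ∈ S)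
    (hne : k ≠ k') : DisjSupp (φ (μ ++ [k])) (φ (μ ++ [k'])) := by
  refine hsep _ h _ h' ?_ ?_
  · simpa [List.prefix_append_right_inj] using hne
  · simpa [List.prefix_append_right_inj] using hne.symm

lemma climb [Fact (1 ≤ p)] {S : Set (List ℕ)} {φ : List ℕ → SumSp ι p}
    (hT : IsTree S) (hs : Summative S φ) (hsep : Separating S φ) {pr : ℝ} {C : Set (List ℕ)}
    (hC : ANMChain pr S φ C) {j : ι} (hB : ∀ μ ∈ C, (φ μ).fst j ≠ 0) (l : List ℕ) :
    ∀ μ ∈ C, μ ++ l ∈ S → (φ (μ ++ l)).fst j ≠ 0 → μ ++ l ∈ C := by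
  induction l with
  | nil => intro μ hμ _ _; simpa using hμ
  | cons k l ih =>
    intro μ hμ hS hj
    have hpre : μ ++ [k] <+: μ ++ k :: l := ⟨l, by simp⟩
    have hkS : μ ++ [k] ∈ S := hT _ hS _ hpre
    have hkj : (φ (μ ++ [k])).fst j ≠ 0 := by
      rw [branch_prefix hT hs hsep hS hpre hj]; exact hj
    obtain ⟨k', hk', -⟩ := hC.2.2 μ hμ ⟨k, hkS⟩
    have hkk : k = k' := by
      by_contra hne
      exact (((disj_iff' _ _).1 (sibling_disj hsep hkS (hC.1 hk') hne)).1 j).elim hkj (hB _ hk')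
    subst hkk
    have e : μ ++ k :: l = (μ ++ [k]) ++ l := by simp
    rw [e] at hS hj ⊢
    exact ih _ hk' hS hj

lemma exists_chain [Fact (1 ≤ p)] (hp : p ≠ ⊤) {S : Set (List ℕ)} {φ : List ℕ → SumSp ι p}
    (hT : IsTree S) (hs : Summative S φ) (hsep : Separating S φ) {C : ℕ → Set (List ℕ)}
    (hC : ∀ n, ANMChain p.toReal S φ (C n)) (hcover : (⋃ n, C n) = S)
    {ν : List ℕ} (hν : ν ∈ S) {j : ι} (hj : (φ ν).fst j ≠ 0) :
    ∃ n, ∀ μ ∈ C n, (φ μ).fst j ≠ 0 := by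
  have hp0 : p ≠ 0 := (zero_lt_one.trans_le Fact.out).ne'
  have hpr : 0 < p.toReal := ENNReal.toReal_pos hp0 hp
  have hmem : ∀ μ ∈ S, ∃ n, μ ∈ C n := fun μ hμ => by
    rw [← hcover] at hμ; exact Set.mem_iUnion.1 hμ
  by_cases hleaf : ∃ μ ∈ S, (φ μ).fst j ≠ 0 ∧ ¬ ∃ k, μ ++ [k] ∈ S
  · obtain ⟨μ, hμ, hμj, hl⟩ := hleaf
    obtain ⟨n, hn⟩ := hmem μ hμ
    refine ⟨n, fun μ' hμ' => ?_⟩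
    have hpre : μ' <+: μ := by
      by_cases he : μ' = μ
      · rw [he]
      · rcases (hC n).2.1 hμ' hn he with a | a
        · exact a
        · obtain ⟨l, rfl⟩ := a
          cases l with
          | nil => simp at he
          | cons k l => exact absurd ⟨k, hT _ ((hC n).1 hμ') _ ⟨l, by simp⟩⟩ hl
    rw [branch_prefix hT hs hsep hμ hpre hμj]; exact hμj
  · push Not at hleaf
    have hnext : ∀ μ : {μ : List ℕ // μ ∈ S ∧ (φ μ).fst j ≠ 0},
        ∃ k, μ.1 ++ [k] ∈ S ∧ (φ (μ.1 ++ [k])).fst j ≠ 0 := fun μ =>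
      branch_child hs μ.2.1 μ.2.2 (hleaf μ.1 μ.2.1 μ.2.2)
    choose nx hnx using hnext
    let m : ℕ → {μ : List ℕ // μ ∈ S ∧ (φ μ).fst j ≠ 0} := fun i =>
      Nat.rec ⟨ν, hν, hj⟩ (fun _ μ => ⟨μ.1 ++ [nx μ], hnx μ⟩) i
    have hm : ∀ i, (m (i+1)).1 = (m i).1 ++ [nx (m i)] := fun i => rfl
    have hlen : ∀ i, i ≤ (m i).1.length := by
      intro i
      induction i with
      | zero => exact Nat.zero_le _
      | succ i ih => rw [hm]; simp; omega
    let N : ℕ → ℝ := fun i => ‖φ (m i).1‖ ^ p.toReal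
    have hsib : ∀ i k, (m i).1 ++ [k] ∈ S → k ≠ nx (m i) →
        ‖φ ((m i).1 ++ [k])‖ ^ p.toReal + N (i+1) ≤ N i := by
      intro i k hk hne
      exact norm_add_le_of_disj hp (child_subvec hT hs hsep hk)
        (child_subvec hT hs hsep (hnx (m i)).1) (sibling_disj hsep hk (hnx (m i)).1 hne)
    have hanti : Antitone N := by
      refine antitone_nat_of_succ_le fun i => ?_
      have := norm_add_le_of_disj hp (child_subvec hT hs hsep (hnx (m i)).1)
        (y := 0) (by rw [subvec_iff']; refine ⟨fun _ => Or.inl rfl, ?_⟩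
                     filter_upwards [Lp.coeFn_zero ℂ p vol01] with t ht
                     exact Or.inl ht)
        (by rw [disj_iff']; refine ⟨fun _ => Or.inr rfl, ?_⟩
            filter_upwards [Lp.coeFn_zero ℂ p vol01] with t ht
            exact Or.inr ht)
      rw [norm_zero, Real.zero_rpow hpr.ne', add_zero] at this
      exact this
    have hlim := tendsto_atTop_ciInf hanti ⟨0, by rintro _ ⟨i, rfl⟩; positivity⟩
    have hdiff : Filter.Tendsto (fun i => N i - N (i+1)) Filter.atTop (nhds 0) := by
      simpa using hlim.sub (hlim.comp (Filter.tendsto_add_atTop_nat 1))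
    have hpow : Filter.Tendsto (fun i : ℕ => ((1:ℝ)/2) ^ i) Filter.atTop (nhds 0) :=
      tendsto_pow_atTop_nhds_zero_of_lt_one (by norm_num) (by norm_num)
    set c : ℝ := ‖(φ ν).fst j‖ ^ p.toReal with hc
    have hcpos : 0 < c := Real.rpow_pos_of_pos (norm_pos_iff.2 hj) _
    have hcN : ∀ i, c ≤ N i := by
      intro i
      rw [hc, branch_eq hT hs hsep hν (m i).2.1 hj (m i).2.2]
      exact Real.rpow_le_rpow (norm_nonneg _) (norm_coord_le _ _) hpr.le
    obtain ⟨I, hI⟩ := Filter.eventually_atTop.1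
      ((hdiff.eventually (gt_mem_nhds (half_pos hcpos))).and
        (hpow.eventually (gt_mem_nhds (half_pos hcpos))))
    obtain ⟨n, hn⟩ := hmem (m I).1 (m I).2.1
    have hall : ∀ i, I ≤ i → (m i).1 ∈ C n := by
      intro i hi
      induction i, hi using Nat.le_induction with
      | base => exact hn
      | succ i hi ih =>
        obtain ⟨k, hkC, hk⟩ := (hC n).2.2 _ ih ⟨_, (hnx (m i)).1⟩
        by_cases hkn : k = nx (m i)
        · rw [hm, ← hkn]; exact hkC
        · exfalso
          have h1 := hsib i k ((hC n).1 hkC) hkn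
          have h2 : N (i+1) ≤ _ := hk _ (hnx (m i)).1
          have h3 : (2:ℝ) ^ (-(((m i).1.length + 1 : ℕ) : ℝ)) ≤ (1/2) ^ i := by
            rw [Real.rpow_neg (by norm_num), Real.rpow_natCast, ← inv_pow, one_div]
            exact pow_le_pow_of_le_one (by norm_num) (by norm_num)
              ((hlen i).trans (Nat.le_succ _))
          have h4 := hI i hi
          have h5 := hcN (i+1)
          linarith [h4.1, h4.2]
    refine ⟨n, fun μ hμ => ?_⟩
    have hi := hall (I + μ.length) (Nat.le_add_right _ _)
    have hpre : μ <+: (m (I + μ.length)).1 := by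
      by_cases he : μ = (m (I + μ.length)).1
      · exact he ▸ List.prefix_rfl
      · rcases (hC n).2.1 hμ hi he with a | a
        · exact a
        · have := hlen (I + μ.length)
          exact absurd (a.eq_of_length (le_antisymm a.length_le (by omega))).symm he
    rw [branch_prefix hT hs hsep (m _).2.1 hpre (m _).2.2]
    exact (m _).2.2

lemma chain_unique [Fact (1 ≤ p)] {S : Set (List ℕ)} {φ : List ℕ → SumSp ι p}
    (hT : IsTree S) (hs : Summative S φ) (hsep : Separating S φ) {pr : ℝ}
    {C : ℕ → Set (List ℕ)}
    (hC : ∀ n, ANMChain pr S φ (C n)) (hne : ∀ n, (C n).Nonempty)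
    (hdisjC : ∀ m n, m ≠ n → Disjoint (C m) (C n)) {j : ι} {m n : ℕ}
    (hm : ∀ μ ∈ C m, (φ μ).fst j ≠ 0) (hn : ∀ μ ∈ C n, (φ μ).fst j ≠ 0) : m = n := by
  by_contra hmn
  obtain ⟨a, ha⟩ := hne m
  obtain ⟨b, hb⟩ := hne n
  have haS := (hC m).1 ha
  have hbS := (hC n).1 hb
  have hd := Set.disjoint_left.1 (hdisjC m n hmn)
  rcases branch_comp hsep haS hbS (hm a ha) (hn b hb) with h | h
  · obtain ⟨l, rfl⟩ := h
    exact hd (climb hT hs hsep (hC m) hm l a ha hbS (hn _ hb)) hb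
  · obtain ⟨l, rfl⟩ := h
    exact hd ha (climb hT hs hsep (hC n) hn l b hb haS (hm _ ha))

lemma main_generic [Fact (1 ≤ p)] (hp : p ≠ ⊤) {S : Set (List ℕ)} {φ : List ℕ → SumSp ι p}
    (hφ : Disintegration S φ)
    (C : ℕ → Set (List ℕ)) (hC : ∀ n, ANMChain p.toReal S φ (C n))
    (hne : ∀ n, (C n).Nonempty)
    (hdisjC : ∀ m n, m ≠ n → Disjoint (C m) (C n)) (hcover : (⋃ n, C n) = S)
    (g : ℕ → SumSp ι p) (hg : ∀ n, SubvecInf (C n) φ (g n)) :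
    ∀ ν ∈ S,
      HasSum (fun n : {n : ℕ // Subvec (g n) (φ ν)} => g n.1) (φ ν - ProjL (φ ν)) := by
  classical
  obtain ⟨hT, -, -, hs, hsep, hd⟩ := hφ
  intro ν hν
  have hdi : ∀ n, ∀ μ ∈ S, DisjSupp (φ μ) (g n) ∨ Subvec (g n) (φ μ) := fun n μ hμ =>
    dichotomy hT hs hsep (hC n) (hne n) (hg n).1 hμ
  have hsnd : ∀ n, (g n).snd = 0 := fun n => common_snd_zero hd (hdi n)
  have hsing : ∀ n i j, (g n).fst j ≠ 0 → i ≠ j → (g n).fst i = 0 := fun n i j h h' =>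
    common_single hd (hdi n) h h'
  have hgj : ∀ n j, (g n).fst j ≠ 0 → ∀ μ ∈ C n, (φ μ).fst j ≠ 0 := by
    intro n j hj μ hμ
    have := (((subvec_iff' _ _).1 ((hg n).1 μ hμ)).1 j).resolve_left hj
    rw [← this]; exact hj
  -- the atoms
  let at' : ι → SumSp ι p := fun j => WithLp.toLp p (lp.single p j ((φ ν).fst j), 0)
  have hex : ∀ j : {j : ι // (φ ν).fst j ≠ 0},
      ∃ n, (∀ μ ∈ C n, (φ μ).fst j.1 ≠ 0) ∧ g n = at' j.1 := by
    rintro ⟨j, hj⟩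
    obtain ⟨n, hn⟩ := exists_chain hp hT hs hsep hC hcover hν hj
    refine ⟨n, hn, ?_⟩
    have hval : ∀ μ ∈ C n, (φ μ).fst j = (φ ν).fst j := fun μ hμ =>
      branch_eq hT hs hsep ((hC n).1 hμ) hν (hn μ hμ) hj
    have h1 : ∀ μ ∈ C n, Subvec (at' j) (φ μ) := by
      intro μ hμ
      rw [subvec_iff']
      refine ⟨fun i => ?_, ?_⟩
      · by_cases hij : i = j
        · subst hij
          right
          simp [at', hval μ hμ]
        · left
          simp [at', lp.single_apply, hij]
      · filter_upwards [Lp.coeFn_zero ℂ p vol01] with t ht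
        exact Or.inl ht
    have h2 := (hg n).2 _ h1
    have h3 : (at' j).fst j = (φ ν).fst j := by simp [at']
    have h4 : (g n).fst j = (φ ν).fst j := by
      have := (((subvec_iff' _ _).1 h2).1 j).resolve_left (by rw [h3]; exact hj)
      rw [← this, h3]
    refine sumsp_ext (fun i => ?_) (hsnd n)
    by_cases hij : i = j
    · subst hij; rw [h4, h3]
    · rw [hsing n i j (by rw [h4]; exact hj) hij]
      simp [at', lp.single_apply, hij]
  choose e he1 he2 using hex
  have hsub : ∀ j, Subvec (g (e j)) (φ ν) := by
    intro j
    rw [he2, subvec_iff']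
    refine ⟨fun i => ?_, ?_⟩
    · by_cases hij : i = j.1
      · right
        rw [hij]
        simp [at']
      · left
        simp [at', lp.single_apply, hij]
    · filter_upwards [Lp.coeFn_zero ℂ p vol01] with t ht
      exact Or.inl ht
  let E : {j : ι // (φ ν).fst j ≠ 0} → {n : ℕ // Subvec (g n) (φ ν)} := fun j => ⟨e j, hsub j⟩
  have hEinj : Function.Injective E := by
    intro i j hij
    have h1 : e i = e j := congrArg Subtype.val hij
    by_contra hne'
    have h2 : at' i.1 = at' j.1 := by rw [← he2, ← he2, h1]
    have h3 : (at' i.1).fst i.1 = (at' j.1).fst i.1 := by rw [h2]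
    have h4 : i.1 ≠ j.1 := fun h => hne' (Subtype.ext h)
    simp [at', lp.single_apply, h4] at h3
    exact i.2 h3
  have hzero : ∀ n : {n : ℕ // Subvec (g n) (φ ν)}, n ∉ Set.range E → g n.1 = 0 := by
    rintro ⟨n, hn⟩ hnr
    refine sumsp_ext (fun j => ?_) (hsnd n)
    by_contra hj
    have hj' : (g n).fst j ≠ 0 := hj
    have h1 := (((subvec_iff' _ _).1 hn).1 j).resolve_left hj'
    have h2 : (φ ν).fst j ≠ 0 := by rw [← h1]; exact hj'
    refine hnr ⟨⟨j, h2⟩, Subtype.ext ?_⟩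
    exact chain_unique hT hs hsep hC hne hdisjC (he1 ⟨j, h2⟩) (hgj n j hj')
  rw [← hEinj.hasSum_iff (f := fun n : {n : ℕ // Subvec (g n) (φ ν)} => g n.1) hzero]
  have hcomp : ((fun n : {n : ℕ // Subvec (g n) (φ ν)} => g n.1) ∘ E)
      = at' ∘ ((↑) : {j : ι // (φ ν).fst j ≠ 0} → ι) := by
    funext j
    exact he2 j
  rw [hcomp]
  have hfull : HasSum at' (φ ν - ProjL (φ ν)) := by
    have h1 := lp.hasSum_single hp (φ ν).fst
    have h2 := ((WithLp.prodContinuousLinearEquiv p ℂ (lp (fun _ : ι => ℂ) p)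
      (Lp ℂ p vol01)).symm.toContinuousLinearMap.comp
        (ContinuousLinearMap.inl ℂ (lp (fun _ : ι => ℂ) p) (Lp ℂ p vol01))).hasSum h1
    have h3 : φ ν - ProjL (φ ν) = WithLp.toLp p ((φ ν).fst, 0) := by
      refine sumsp_ext (fun j => ?_) ?_
      · change (φ ν).fst j - 0 = (φ ν).fst j
        rw [sub_zero]
      · change (φ ν).snd - (φ ν).snd = 0
        rw [sub_self]
    rw [h3]
    exact h2
  refine (hasSum_subtype_iff_of_support_subset (s := {j : ι | (φ ν).fst j ≠ 0}) ?_).2 hfull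
  intro j hj hj0
  apply hj
  refine sumsp_ext (fun i => ?_) rfl
  change (at' j).fst i = 0
  by_cases hij : i = j
  · subst hij
    simpa [at'] using hj0
  · simp [at', lp.single_apply, hij]

end Helpers

/-- Let `φ : S → M ⊕_p L^p[0,1]` be a disintegration (`M = ℓ^p` or `ℓ^p_n`), `{C n}` a
partition of `S` into almost norm-maximizing chains, and `g n = inf φ[C n]`.  Then for each
`ν ∈ S`, the projection of `φ ν` onto `{0} ⊕ L^p[0,1]` equals
`φ ν - Σ_{n : g n ⪯ φ ν} g n`. -/
theorem stmt19 {ι : Type} (p : ℝ) (hp : 1 ≤ p) [Fact (1 ≤ ENNReal.ofReal p)]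
    (S : Set (List ℕ)) (φ : List ℕ → SumSp ι (ENNReal.ofReal p))
    (hφ : Disintegration S φ)
    (C : ℕ → Set (List ℕ)) (hchain : ∀ n, ANMChain p S φ (C n))
    (hne : ∀ n, (C n).Nonempty)
    (hdisjC : ∀ m n, m ≠ n → Disjoint (C m) (C n)) (hcover : (⋃ n, C n) = S)
    (g : ℕ → SumSp ι (ENNReal.ofReal p)) (hg : ∀ n, SubvecInf (C n) φ (g n)) :
    ∀ ν ∈ S,
      HasSum (fun n : {n : ℕ // Subvec (g n) (φ ν)} => g n.1) (φ ν - ProjL (φ ν)) := by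
  have h := ENNReal.toReal_ofReal (zero_le_one.trans hp)
  refine main_generic ENNReal.ofReal_ne_top hφ C ?_ hne hdisjC hcover g hg
  rw [h]
  exact hchain
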